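/- For each M, let Ā_M ∈ ℂ^{M×M} be a random Hermitian positive definite matrix with ‖Ā_M‖₂ and ‖Ā_M^{-1}‖₂ uniformly bounded (almost surely), and let L_M, R_M ∈ ℂ^{M×M} be random matrices with uniformly bounded spectral norms. Let x_M, y_M ∈ ℂ^M be random vectors with i.i.d. complex entries of zero mean, unit variance, and finite eighth-order moment, mutually independent and independent of (L_M, R_M, Ā_M). Let c_0, c_1, c_2 ≥ 0 be constants with c_0 + c_1 = 1 and c_0 c_1 − c_2² = 0, and define A_M ≜ Ā_M + (1/M)·( c_0 x x^H + c_1 y y^H + c_2 x y^H + c_2 y x^H ). Define u ≜ (1/M)·tr(Ā^{-1}), u_L ≜ (1/M)·tr(L Ā^{-1}), u_R ≜ (1/M)·tr(Ā^{-1} R), u_{LR} ≜ (1/M)·tr(L Ā^{-1} R). Then, almost surely as M → ∞: (i) (1/M)·x^H L A^{-1} R x − [ u_{LR} − c_0 u_L u_R (1 + c_1 u)/(1 + u) + c_2² u_L u_R · u/(1 + u) ] → 0, and (ii) (1/M)·x^H L A^{-1} R y − [ c_1 c_2 u_L u_R · u/(1 + u) − c_2 u_L u_R (1 + c_1 u)/(1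 + u) ] → 0. -/

import Mathlib

open MeasureTheory ProbabilityTheory Filter Matrix
open scoped ComplexOrder

/-- The spectral norm (largest singular value) of a complex matrix. -/
noncomputable def specNorm {m n : Type*} [Fintype m] [Fintype n] [DecidableEq n]
    (A : Matrix m n ℂ) : ℝ :=
  ‖LinearMap.toContinuousLinearMap (Matrix.toEuclideanLin A)‖

section FourthMoments

open ComplexConjugate

variable {Ω : Type*} {ι : Type*} [MeasurableSpace Ω] {μ : Measure Ω}

lemma norm_add_pow_four_le (a b : ℂ) :
    ‖a + b‖ ^ 4 ≤ ‖a‖ ^ 4 + 4 * (((‖a‖ ^ 2 : ℝ) : ℂ) * conj a * b).re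
      + 8 * (‖a‖ ^ 2 * ‖b‖ ^ 2) + 3 * ‖b‖ ^ 4 := by
  have hre : (((‖a‖ ^ 2 : ℝ) : ℂ) * conj a * b).re = ‖a‖ ^ 2 * (conj a * b).re := by
    rw [mul_assoc, Complex.re_ofReal_mul]
  have hsq : ‖a + b‖ ^ 2 = ‖a‖ ^ 2 + 2 * (conj a * b).re + ‖b‖ ^ 2 := by
    simp only [← Complex.normSq_eq_norm_sq, Complex.normSq_apply, Complex.add_re, Complex.add_im,
      Complex.mul_re, Complex.conj_re, Complex.conj_im]
    ring
  have habs : |(conj a * b).re| ≤ ‖a‖ * ‖b‖ := by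
    simpa using Complex.abs_re_le_norm (conj a * b)
  rw [hre, show ‖a + b‖ ^ 4 = (‖a + b‖ ^ 2) ^ 2 by ring, hsq]
  generalize (conj a * b).re = r at *
  have h1 : r ^ 2 ≤ (‖a‖ * ‖b‖) ^ 2 := sq_le_sq' (abs_le.1 habs).1 (abs_le.1 habs).2
  have h2 : r * ‖b‖ ^ 2 ≤ ‖a‖ * ‖b‖ * ‖b‖ ^ 2 :=
    mul_le_mul_of_nonneg_right (abs_le.1 habs).2 (by positivity)
  nlinarith [sq_nonneg (‖a‖ * ‖b‖ - ‖b‖ ^ 2)]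

lemma norm_cube_mul_le (a b : ℂ) : ‖a‖ ^ 3 * ‖b‖ ≤ ‖a‖ ^ 4 + ‖b‖ ^ 4 := by
  have ha := norm_nonneg a
  have hb := norm_nonneg b
  rcases le_total ‖a‖ ‖b‖ with h | h
  · have : ‖a‖ ^ 3 * ‖b‖ ≤ ‖b‖ ^ 3 * ‖b‖ := by gcongr
    nlinarith [pow_nonneg ha 4]
  · have : ‖a‖ ^ 3 * ‖b‖ ≤ ‖a‖ ^ 3 * ‖a‖ := by gcongr
    nlinarith [pow_nonneg hb 4]

lemma integrable_norm_pow_four {f : Ω → ℂ} (hf : MemLp f 4 μ) :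
    Integrable (fun ω => ‖f ω‖ ^ 4) μ :=
  MemLp.integrable_norm_pow (p := 4) (by simpa using hf) (by norm_num)

lemma integrable_normSq_mul_conj_mul {S D : Ω → ℂ} (hS : MemLp S 4 μ) (hD : MemLp D 4 μ) :
    Integrable (fun ω => ((‖S ω‖ ^ 2 : ℝ) : ℂ) * conj (S ω) * D ω) μ := by
  refine ((integrable_norm_pow_four hS).add (integrable_norm_pow_four hD)).mono' ?_ ?_
  · refine AEStronglyMeasurable.mul (AEStronglyMeasurable.mul ?_ ?_) hD.1
    · exact Complex.continuous_ofReal.comp_aestronglyMeasurable (hS.1.norm.pow 2)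
    · exact Complex.continuous_conj.comp_aestronglyMeasurable hS.1
  · filter_upwards with ω
    have := norm_cube_mul_le (S ω) (D ω)
    calc _ = ‖S ω‖ ^ 3 * ‖D ω‖ := by
          simp only [norm_mul, Complex.norm_real, norm_pow, norm_norm, RCLike.norm_conj]
          ring
      _ ≤ _ := this

lemma integral_normSq_mul_normSq_le {S D : Ω → ℂ} {s d : ℝ} (hS : MemLp S 4 μ)
    (hD : MemLp D 4 μ) (hs : 0 ≤ s) (hd : 0 ≤ d) (hSs : ∫ ω, ‖S ω‖ ^ 4 ∂μ ≤ s ^ 2)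
    (hDd : ∫ ω, ‖D ω‖ ^ 4 ∂μ ≤ d ^ 2) :
    ∫ ω, ‖S ω‖ ^ 2 * ‖D ω‖ ^ 2 ∂μ ≤ s * d := by
  have hL2 : ∀ {f : Ω → ℂ}, MemLp f 4 μ → MemLp (fun ω => ‖f ω‖ ^ 2) (ENNReal.ofReal 2) μ := by
    intro f hf
    rw [show ENNReal.ofReal 2 = 2 by simp]
    refine (memLp_two_iff_integrable_sq (hf.1.norm.pow 2)).2 ?_
    simpa [← pow_mul] using integrable_norm_pow_four hf
  have h := integral_mul_le_Lp_mul_Lq_of_nonneg (μ := μ) Real.HolderConjugate.two_two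
    (f := fun ω => ‖S ω‖ ^ 2) (g := fun ω => ‖D ω‖ ^ 2)
    (ae_of_all _ fun ω => by positivity) (ae_of_all _ fun ω => by positivity) (hL2 hS) (hL2 hD)
  refine h.trans ?_
  have hpow : ∀ t : ℝ, (t ^ 2) ^ (2 : ℝ) = t ^ 4 := by
    intro t
    rw [show (2 : ℝ) = ((2 : ℕ) : ℝ) by norm_num, Real.rpow_natCast, ← pow_mul]
  simp only [hpow, ← Real.sqrt_eq_rpow]
  exact mul_le_mul (Real.sqrt_le_iff.2 ⟨hs, hSs⟩) (Real.sqrt_le_iff.2 ⟨hd, hDd⟩)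
    (Real.sqrt_nonneg _) hs

/-- The fourth moment after adding a martingale increment. -/
lemma integral_norm_add_pow_four_le {S D : Ω → ℂ} {s d : ℝ} (hS : MemLp S 4 μ)
    (hD : MemLp D 4 μ) (hs : 0 ≤ s) (hd : 0 ≤ d) (hSs : ∫ ω, ‖S ω‖ ^ 4 ∂μ ≤ s ^ 2)
    (hDd : ∫ ω, ‖D ω‖ ^ 4 ∂μ ≤ d ^ 2)
    (horth : ∫ ω, ((‖S ω‖ ^ 2 : ℝ) : ℂ) * conj (S ω) * D ω ∂μ = 0) :
    ∫ ω, ‖S ω + D ω‖ ^ 4 ∂μ ≤ (s + 4 * d) ^ 2 := by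
  have hI := integrable_normSq_mul_conj_mul hS hD
  have hre : ∫ ω, (((‖S ω‖ ^ 2 : ℝ) : ℂ) * conj (S ω) * D ω).re ∂μ = 0 := by
    have := integral_re hI
    simp only [RCLike.re_eq_complex_re] at this
    rw [this, horth, Complex.zero_re]
  have hIre : Integrable (fun ω => (((‖S ω‖ ^ 2 : ℝ) : ℂ) * conj (S ω) * D ω).re) μ := hI.re
  have hS4 := integrable_norm_pow_four hS
  have hD4 := integrable_norm_pow_four hD
  have hSD : Integrable (fun ω => ‖S ω‖ ^ 2 * ‖D ω‖ ^ 2) μ := by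
    refine (hS4.add hD4).mono' ((hS.1.norm.pow 2).mul (hD.1.norm.pow 2)) ?_
    filter_upwards with ω
    rw [Real.norm_of_nonneg (by positivity)]
    change _ ≤ ‖S ω‖ ^ 4 + ‖D ω‖ ^ 4
    nlinarith [sq_nonneg (‖S ω‖ ^ 2 - ‖D ω‖ ^ 2), sq_nonneg (‖S ω‖ ^ 2 + ‖D ω‖ ^ 2)]
  have hmul := integral_normSq_mul_normSq_le hS hD hs hd hSs hDd
  calc ∫ ω, ‖S ω + D ω‖ ^ 4 ∂μ
      ≤ ∫ ω, (‖S ω‖ ^ 4 + 4 * (((‖S ω‖ ^ 2 : ℝ) : ℂ) * conj (S ω) * D ω).re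
        + 8 * (‖S ω‖ ^ 2 * ‖D ω‖ ^ 2) + 3 * ‖D ω‖ ^ 4) ∂μ := by
        refine integral_mono (integrable_norm_pow_four (hS.add hD)) ?_
          fun ω => norm_add_pow_four_le _ _
        exact ((hS4.add (hIre.const_mul 4)).add (hSD.const_mul 8)).add (hD4.const_mul 3)
    _ = ∫ ω, ‖S ω‖ ^ 4 ∂μ + 4 * 0 + 8 * ∫ ω, ‖S ω‖ ^ 2 * ‖D ω‖ ^ 2 ∂μ
        + 3 * ∫ ω, ‖D ω‖ ^ 4 ∂μ := by
        have i₁ := hIre.const_mul 4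
        have i₂ := hSD.const_mul 8
        rw [integral_add (by fun_prop) (hD4.const_mul 3), integral_add (by fun_prop) i₂,
          integral_add hS4 i₁, integral_const_mul, integral_const_mul, integral_const_mul, hre]
    _ ≤ (s + 4 * d) ^ 2 := by nlinarith [sq_nonneg d]

/-- Independence of a function of `X i`, `i ∈ s`, and a function of `X a`, `a ∉ s`. -/
lemma indepFun_of_measurable_iSup_comap {X : ι → Ω → ℂ} (hX : ∀ i, Measurable (X i))
    (hind : iIndepFun X μ) {s : Finset ι} {a : ι} (ha : a ∉ s) {U : Ω → ℂ}
    (hU : Measurable[⨆ i ∈ s, MeasurableSpace.comap (X i) inferInstance] U)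
    {g : ℂ → ℂ} (hg : Measurable g) : IndepFun U (fun ω => g (X a ω)) μ := by
  have h := indep_iSup_of_disjoint (fun i => (hX i).comap_le) hind
    (S := (s : Set ι)) (T := {a}) (by simpa using ha)
  rw [IndepFun_iff_Indep]
  refine indep_of_indep_of_le_left (indep_of_indep_of_le_right h ?_) ?_
  · simp only [Set.mem_singleton_iff, iSup_iSup_eq_left]
    rintro _ ⟨t, ht, rfl⟩
    exact ⟨g ⁻¹' t, hg ht, rfl⟩
  · simpa using hU.comap_le

lemma measurable_iSup_comap {Ω : Type*} {X : ι → Ω → ℂ} {s : Finset ι} {i : ι} (hi : i ∈ s) :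
    Measurable[⨆ j ∈ s, MeasurableSpace.comap (X j) inferInstance] (X i) :=
  Measurable.mono (comap_measurable (X i))
    (le_iSup₂ (f := fun j (_ : j ∈ s) => MeasurableSpace.comap (X j) inferInstance) i hi) le_rfl

lemma measurable_sum_mul {Ω : Type*} [MeasurableSpace Ω] {X : ι → Ω → ℂ} {s : Finset ι}
    (hX : ∀ i ∈ s, Measurable (X i)) (b : ι → ℂ) :
    Measurable (fun ω => ∑ i ∈ s, b i * X i ω) :=
  Finset.measurable_fun_sum _ fun i hi => (hX i hi).const_mul _

/-- The quadratic form of the matrix `B` restricted to `s`, minus its trace. -/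
noncomputable def centeredForm (B : ι → ι → ℂ) (s : Finset ι) (z : ι → ℂ) : ℂ :=
  ∑ i ∈ s, ∑ j ∈ s, conj (z i) * B i j * z j - ∑ i ∈ s, B i i

lemma measurable_centeredForm {Ω : Type*} [MeasurableSpace Ω] {X : ι → Ω → ℂ} {s : Finset ι}
    (hX : ∀ i ∈ s, Measurable (X i)) (B : ι → ι → ℂ) :
    Measurable (fun ω => centeredForm B s (fun i => X i ω)) := by
  unfold centeredForm
  refine Measurable.sub_const (Finset.measurable_fun_sum _ fun i hi =>
    Finset.measurable_fun_sum _ fun j hj => ?_) _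
  have h1 := hX i hi
  have h2 := hX j hj
  exact ((Complex.continuous_conj.measurable.comp h1).mul_const _).mul h2

lemma integral_mul_eq_zero_of_indep {U V : Ω → ℂ} (h : IndepFun U V μ)
    (hU : Measurable U) (hV : Measurable V) (h0 : ∫ ω, V ω ∂μ = 0) :
    ∫ ω, U ω * V ω ∂μ = 0 := by
  rw [h.integral_fun_mul_eq_mul_integral hU.aestronglyMeasurable hV.aestronglyMeasurable, h0,
    mul_zero]

lemma integral_norm_mul_pow_four {U V : Ω → ℂ} (h : IndepFun U V μ)
    (hU : Measurable U) (hV : Measurable V) :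
    ∫ ω, ‖U ω * V ω‖ ^ 4 ∂μ = (∫ ω, ‖U ω‖ ^ 4 ∂μ) * ∫ ω, ‖V ω‖ ^ 4 ∂μ := by
  have h' := h.comp (φ := fun w : ℂ => ‖w‖ ^ 4) (ψ := fun w : ℂ => ‖w‖ ^ 4)
    (by fun_prop) (by fun_prop)
  simp only [norm_mul, mul_pow]
  exact h'.integral_fun_mul_eq_mul_integral (by fun_prop) (by fun_prop)

lemma integral_norm_sum_pow_four_le [IsProbabilityMeasure μ] {X : ι → Ω → ℂ}
    (hX : ∀ i, Measurable (X i)) (hind : iIndepFun X μ) (h4 : ∀ i, MemLp (X i) 4 μ)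
    (h0 : ∀ i, ∫ ω, X i ω ∂μ = 0) {m : ℝ} (hm : 0 ≤ m)
    (hm4 : ∀ i, ∫ ω, ‖X i ω‖ ^ 4 ∂μ ≤ m ^ 2) (b : ι → ℂ) (s : Finset ι) :
    ∫ ω, ‖∑ i ∈ s, b i * X i ω‖ ^ 4 ∂μ ≤ (4 * m * ∑ i ∈ s, ‖b i‖ ^ 2) ^ 2 := by
  classical
  induction s using Finset.induction_on with
  | empty => simp
  | insert a s ha ih =>
    have hSm : Measurable[⨆ i ∈ s, MeasurableSpace.comap (X i) inferInstance]
        (fun ω => ∑ i ∈ s, b i * X i ω) :=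
      @measurable_sum_mul ι Ω (_) X s (fun i hi => measurable_iSup_comap hi) b
    have hSm' := measurable_sum_mul (s := s) (fun i _ => hX i) b
    simp only [Finset.sum_insert ha]
    have hD : MemLp (fun ω => b a * X a ω) 4 μ := (h4 a).const_mul _
    have hS : MemLp (fun ω => ∑ i ∈ s, b i * X i ω) 4 μ :=
      memLp_finsetSum _ fun i _ => (h4 i).const_mul _
    have hDd : ∫ ω, ‖b a * X a ω‖ ^ 4 ∂μ ≤ (m * ‖b a‖ ^ 2) ^ 2 := by
      simp only [norm_mul, mul_pow, integral_const_mul]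
      nlinarith [mul_le_mul_of_nonneg_left (hm4 a) (pow_nonneg (norm_nonneg (b a)) 4)]
    have key := integral_norm_add_pow_four_le hS hD (s := 4 * m * ∑ i ∈ s, ‖b i‖ ^ 2)
      (by positivity) (by positivity) ih hDd ?_
    · refine le_of_eq_of_le ?_ (key.trans_eq ?_)
      · simp only [add_comm]
      · ring
    · set W : Ω → ℂ := fun ω => ∑ i ∈ s, b i * X i ω with hW
      have hind' : IndepFun (fun ω => ((‖W ω‖ ^ 2 : ℝ) : ℂ) * conj (W ω) * b a) (X a) μ := by
        refine indepFun_of_measurable_iSup_comap hX hind ha (g := id) ?_ measurable_id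
        exact (show Measurable (fun w : ℂ => ((‖w‖ ^ 2 : ℝ) : ℂ) * conj w * b a) by fun_prop).comp
          hSm
      simp only [← mul_assoc]
      exact integral_mul_eq_zero_of_indep hind' (by fun_prop) (hX a) (h0 a)

lemma centeredForm_insert [DecidableEq ι] (B : ι → ι → ℂ) {s : Finset ι} {a : ι} (ha : a ∉ s)
    (z : ι → ℂ) :
    centeredForm B (insert a s) z = centeredForm B s z
      + ((∑ j ∈ s, B a j * z j) * conj (z a) + (∑ i ∈ s, B i a * conj (z i)) * z a
        + B a a * (conj (z a) * z a - 1)) := by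
  simp only [centeredForm, Finset.sum_insert ha, Finset.sum_add_distrib, Finset.sum_mul]
  have h1 : ∀ j, conj (z a) * B a j * z j = B a j * z j * conj (z a) := fun j => by ring
  have h2 : ∀ i, conj (z i) * B i a * z a = B i a * conj (z i) * z a := fun i => by ring
  simp only [h1, h2]
  ring

lemma norm_add_three_pow_four_le (a b c : ℂ) :
    ‖a + b + c‖ ^ 4 ≤ 27 * (‖a‖ ^ 4 + ‖b‖ ^ 4 + ‖c‖ ^ 4) := by
  have h : ‖a + b + c‖ ^ 4 ≤ (‖a‖ + ‖b‖ + ‖c‖) ^ 4 := by gcongr; exact norm_add₃_le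
  refine h.trans ?_
  have h2 : (‖a‖ + ‖b‖ + ‖c‖) ^ 2 ≤ 3 * (‖a‖ ^ 2 + ‖b‖ ^ 2 + ‖c‖ ^ 2) := by
    nlinarith [sq_nonneg (‖a‖ - ‖b‖), sq_nonneg (‖a‖ - ‖c‖), sq_nonneg (‖b‖ - ‖c‖)]
  calc (‖a‖ + ‖b‖ + ‖c‖) ^ 4 = ((‖a‖ + ‖b‖ + ‖c‖) ^ 2) ^ 2 := by ring
    _ ≤ (3 * (‖a‖ ^ 2 + ‖b‖ ^ 2 + ‖c‖ ^ 2)) ^ 2 := by gcongr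
    _ ≤ _ := by
      nlinarith [sq_nonneg (‖a‖ ^ 2 - ‖b‖ ^ 2), sq_nonneg (‖a‖ ^ 2 - ‖c‖ ^ 2),
        sq_nonneg (‖b‖ ^ 2 - ‖c‖ ^ 2)]

lemma memLp_four_mul {f g : Ω → ℂ} (hf : MemLp f 8 μ) (hg : MemLp g 8 μ) :
    MemLp (fun ω => f ω * g ω) 4 μ := by
  have : ENNReal.HolderTriple 8 8 4 := by
    constructor
    rw [← two_mul, show (8 : ENNReal) = 2 * 4 by norm_num,
      ENNReal.mul_inv (by norm_num) (by norm_num), ← mul_assoc,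
      ENNReal.mul_inv_cancel (by norm_num) (by norm_num), one_mul]
  exact MemLp.mul' hg hf

/-- Fourth-moment bound for a centered quadratic form in independent centered variables, in terms
of the Frobenius norm of the matrix. -/
lemma integral_norm_centeredForm_pow_four_le [IsProbabilityMeasure μ] {X : ι → Ω → ℂ}
    (hX : ∀ i, Measurable (X i)) (hind : iIndepFun X μ) (h8 : ∀ i, MemLp (X i) 8 μ)
    (h0 : ∀ i, ∫ ω, X i ω ∂μ = 0) (h1 : ∀ i, ∫ ω, (conj (X i ω) * X i ω - 1) ∂μ = 0)
    {m k : ℝ} (hm : 0 ≤ m) (hm4 : ∀ i, ∫ ω, ‖X i ω‖ ^ 4 ∂μ ≤ m ^ 2)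
    (hk : ∀ i, ∫ ω, ‖conj (X i ω) * X i ω - 1‖ ^ 4 ∂μ ≤ k ^ 2)
    (B : ι → ι → ℂ) (s : Finset ι) :
    MemLp (fun ω => centeredForm B s (fun i => X i ω)) 4 μ ∧
    ∫ ω, ‖centeredForm B s (fun i => X i ω)‖ ^ 4 ∂μ
      ≤ (4 * √(27 * (16 * m ^ 4 + k ^ 2)) * ∑ i ∈ s, ∑ j ∈ s, ‖B i j‖ ^ 2) ^ 2 := by
  classical
  set C := √(27 * (16 * m ^ 4 + k ^ 2)) with hC
  have hC2 : C ^ 2 = 27 * (16 * m ^ 4 + k ^ 2) := Real.sq_sqrt (by positivity)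
  have hC0 : 0 ≤ C := Real.sqrt_nonneg _
  have h4 : ∀ i, MemLp (X i) 4 μ := fun i => (h8 i).mono_exponent (by norm_num)
  have hconj8 : ∀ i, MemLp (fun ω => conj (X i ω)) 8 μ := fun i => (h8 i).star
  have hconj4 : ∀ i, MemLp (fun ω => conj (X i ω)) 4 μ := fun i => (h4 i).star
  have hconjm : ∀ i, Measurable fun ω => conj (X i ω) := fun i =>
    Complex.continuous_conj.measurable.comp (hX i)
  have hconj0 : ∀ i, ∫ ω, conj (X i ω) ∂μ = 0 := fun i => by rw [integral_conj, h0, map_zero]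
  have hconjind : iIndepFun (fun i ω => conj (X i ω)) μ :=
    hind.comp (fun _ => (conj : ℂ → ℂ)) fun _ => Complex.continuous_conj.measurable
  have hsqL : ∀ i, MemLp (fun ω => conj (X i ω) * X i ω - 1) 4 μ := fun i =>
    (memLp_four_mul (hconj8 i) (h8 i)).sub (memLp_const 1)
  induction s using Finset.induction_on with
  | empty => simp [centeredForm]
  | insert a s ha ih =>
    obtain ⟨hS, hSs⟩ := ih
    simp only [centeredForm_insert B ha]
    set S : Ω → ℂ := fun ω => centeredForm B s (fun i => X i ω) with hSdef
    set l₁ : Ω → ℂ := fun ω => ∑ j ∈ s, B a j * X j ω with hl₁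
    set l₂ : Ω → ℂ := fun ω => ∑ i ∈ s, B i a * conj (X i ω) with hl₂
    have hSm : Measurable S := measurable_centeredForm (fun i _ => hX i) B
    have hl₁m : Measurable l₁ := measurable_sum_mul (fun i _ => hX i) _
    have hl₂m : Measurable l₂ := measurable_sum_mul (fun i _ => hconjm i) _
    have hSm' : Measurable[⨆ i ∈ s, MeasurableSpace.comap (X i) inferInstance] S :=
      @measurable_centeredForm ι Ω (_) X s (fun i hi => measurable_iSup_comap hi) B
    have hl₁m' : Measurable[⨆ i ∈ s, MeasurableSpace.comap (X i) inferInstance] l₁ :=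
      @measurable_sum_mul ι Ω (_) X s (fun i hi => measurable_iSup_comap hi) _
    have hl₂m' : Measurable[⨆ i ∈ s, MeasurableSpace.comap (X i) inferInstance] l₂ :=
      @measurable_sum_mul ι Ω (_) (fun i ω => conj (X i ω)) s
        (fun i hi => Complex.continuous_conj.measurable.comp (measurable_iSup_comap hi)) _
    have hl₁L : MemLp l₁ 8 μ := memLp_finsetSum _ fun i _ => (h8 i).const_mul _
    have hl₂L : MemLp l₂ 8 μ := memLp_finsetSum _ fun i _ => (hconj8 i).const_mul _
    have hT₁ : MemLp (fun ω => l₁ ω * conj (X a ω)) 4 μ := memLp_four_mul hl₁L (hconj8 a)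
    have hT₂ : MemLp (fun ω => l₂ ω * X a ω) 4 μ := memLp_four_mul hl₂L (h8 a)
    have hT₃ : MemLp (fun ω => B a a * (conj (X a ω) * X a ω - 1)) 4 μ := (hsqL a).const_mul _
    have hD : MemLp (fun ω => l₁ ω * conj (X a ω) + l₂ ω * X a ω
        + B a a * (conj (X a ω) * X a ω - 1)) 4 μ := (hT₁.add hT₂).add hT₃
    refine ⟨hS.add hD, ?_⟩
    set r := ∑ j ∈ s, ‖B a j‖ ^ 2 with hr
    set c := ∑ i ∈ s, ‖B i a‖ ^ 2 with hc
    have hr0 : 0 ≤ r := by positivity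
    have hc0 : 0 ≤ c := by positivity
    have hI₁ : ∫ ω, ‖l₁ ω * conj (X a ω)‖ ^ 4 ∂μ ≤ (4 * m * r) ^ 2 * m ^ 2 := by
      rw [integral_norm_mul_pow_four (indepFun_of_measurable_iSup_comap hX hind ha hl₁m'
        Complex.continuous_conj.measurable) hl₁m (hconjm a)]
      refine mul_le_mul (integral_norm_sum_pow_four_le hX hind h4 h0 hm hm4 _ s) ?_
        (by positivity) (by positivity)
      simpa using hm4 a
    have hI₂ : ∫ ω, ‖l₂ ω * X a ω‖ ^ 4 ∂μ ≤ (4 * m * c) ^ 2 * m ^ 2 := by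
      rw [integral_norm_mul_pow_four (V := X a) (indepFun_of_measurable_iSup_comap hX hind ha hl₂m'
        measurable_id) hl₂m (hX a)]
      exact mul_le_mul (integral_norm_sum_pow_four_le hconjm hconjind hconj4 hconj0 hm
        (fun i => by simpa using hm4 i) _ s) (hm4 a) (by positivity) (by positivity)
    have hI₃ : ∫ ω, ‖B a a * (conj (X a ω) * X a ω - 1)‖ ^ 4 ∂μ ≤ (‖B a a‖ ^ 2) ^ 2 * k ^ 2 := by
      simp only [norm_mul (B a a), mul_pow, integral_const_mul]
      rw [← pow_mul]
      exact mul_le_mul_of_nonneg_left (hk a) (by positivity)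
    have hDd : ∫ ω, ‖l₁ ω * conj (X a ω) + l₂ ω * X a ω
        + B a a * (conj (X a ω) * X a ω - 1)‖ ^ 4 ∂μ ≤ (C * (r + c + ‖B a a‖ ^ 2)) ^ 2 := by
      have i₁ := integrable_norm_pow_four hT₁
      have i₂ := integrable_norm_pow_four hT₂
      have i₃ := integrable_norm_pow_four hT₃
      calc _ ≤ ∫ ω, 27 * (‖l₁ ω * conj (X a ω)‖ ^ 4 + ‖l₂ ω * X a ω‖ ^ 4
            + ‖B a a * (conj (X a ω) * X a ω - 1)‖ ^ 4) ∂μ :=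
            integral_mono (integrable_norm_pow_four hD) (((i₁.add i₂).add i₃).const_mul 27)
              fun ω => norm_add_three_pow_four_le _ _ _
        _ = 27 * (∫ ω, ‖l₁ ω * conj (X a ω)‖ ^ 4 ∂μ + ∫ ω, ‖l₂ ω * X a ω‖ ^ 4 ∂μ
            + ∫ ω, ‖B a a * (conj (X a ω) * X a ω - 1)‖ ^ 4 ∂μ) := by
            rw [integral_const_mul, integral_add (by fun_prop) i₃, integral_add i₁ i₂]
        _ ≤ 27 * ((4 * m * r) ^ 2 * m ^ 2 + (4 * m * c) ^ 2 * m ^ 2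
            + (‖B a a‖ ^ 2) ^ 2 * k ^ 2) := by gcongr
        _ ≤ 27 * (16 * m ^ 4 + k ^ 2) * (r ^ 2 + c ^ 2 + (‖B a a‖ ^ 2) ^ 2) := by
            nlinarith [mul_nonneg (sq_nonneg k) (sq_nonneg r), mul_nonneg (sq_nonneg k)
              (sq_nonneg c), mul_nonneg (pow_nonneg hm 4) (sq_nonneg (‖B a a‖ ^ 2))]
        _ ≤ 27 * (16 * m ^ 4 + k ^ 2) * (r + c + ‖B a a‖ ^ 2) ^ 2 := by
            gcongr
            nlinarith [mul_nonneg hr0 hc0, mul_nonneg hr0 (sq_nonneg ‖B a a‖),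
              mul_nonneg hc0 (sq_nonneg ‖B a a‖)]
        _ = _ := by rw [mul_pow, hC2]
    refine (integral_norm_add_pow_four_le hS hD (by positivity) (by positivity) hSs hDd ?_).trans_eq
      ?_
    · set W : Ω → ℂ := fun ω => ((‖S ω‖ ^ 2 : ℝ) : ℂ) * conj (S ω) with hW
      have hφ : Measurable fun w : ℂ => ((‖w‖ ^ 2 : ℝ) : ℂ) * conj w := by fun_prop
      have hWm : Measurable W := hφ.comp hSm
      have hWm' : Measurable[⨆ i ∈ s, MeasurableSpace.comap (X i) inferInstance] W :=
        hφ.comp hSm'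
      have z₁ : ∫ ω, W ω * (l₁ ω * conj (X a ω)) ∂μ = 0 := by
        simp only [← mul_assoc]
        exact integral_mul_eq_zero_of_indep (U := fun ω => W ω * l₁ ω)
          (indepFun_of_measurable_iSup_comap hX hind ha
          (@Measurable.mul _ _ _ _ _ (_) _ _ hWm' hl₁m') Complex.continuous_conj.measurable)
          (hWm.mul hl₁m) (hconjm a) (hconj0 a)
      have z₂ : ∫ ω, W ω * (l₂ ω * X a ω) ∂μ = 0 := by
        simp only [← mul_assoc]
        exact integral_mul_eq_zero_of_indep (U := fun ω => W ω * l₂ ω)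
          (indepFun_of_measurable_iSup_comap hX hind ha
          (@Measurable.mul _ _ _ _ _ (_) _ _ hWm' hl₂m') measurable_id)
          (hWm.mul hl₂m) (hX a) (h0 a)
      have z₃ : ∫ ω, W ω * (B a a * (conj (X a ω) * X a ω - 1)) ∂μ = 0 := by
        have hg : Measurable fun w : ℂ => B a a * (conj w * w - 1) := by fun_prop
        refine integral_mul_eq_zero_of_indep (indepFun_of_measurable_iSup_comap hX hind ha
          hWm' hg) hWm (hg.comp (hX a)) ?_
        simp [integral_const_mul, h1]
      simp only [mul_add]
      rw [integral_add, integral_add, z₁, z₂, z₃]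
      · simp
      · exact integrable_normSq_mul_conj_mul hS hT₁
      · exact integrable_normSq_mul_conj_mul hS hT₂
      · exact (integrable_normSq_mul_conj_mul hS hT₁).add (integrable_normSq_mul_conj_mul hS hT₂)
      · exact integrable_normSq_mul_conj_mul hS hT₃
    · simp only [Finset.sum_insert ha, Finset.sum_add_distrib]
      ring

end FourthMoments

section Concentration

open ComplexConjugate
open scoped ENNReal

variable {Ω : Type*} [MeasurableSpace Ω] {μ : Measure Ω}

lemma measurePreserving_coordinate {ι : Type*} [Fintype ι] {ν : Measure ℂ} [IsProbabilityMeasure ν]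
    {z : Ω → ι → ℂ} (hz : Measurable z) (hlaw : μ.map z = Measure.pi fun _ => ν) (i : ι) :
    MeasurePreserving (fun ω => z ω i) μ ν := by
  have h1 : MeasurePreserving z μ (Measure.pi fun _ => ν) := ⟨hz, hlaw⟩
  exact (measurePreserving_eval (fun _ : ι => ν) i).comp h1

variable [IsProbabilityMeasure μ]

lemma iIndepFun_coordinate {ι : Type*} [Fintype ι] {ν : Measure ℂ} [IsProbabilityMeasure ν]
    {z : Ω → ι → ℂ} (hz : Measurable z) (hlaw : μ.map z = Measure.pi fun _ => ν) :
    iIndepFun (fun i ω => z ω i) μ := by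
  rw [iIndepFun_iff_map_fun_eq_pi_map
    fun i => (measurePreserving_coordinate hz hlaw i).measurable.aemeasurable]
  simp only [(measurePreserving_coordinate hz hlaw _).map_eq]
  exact hlaw

/-- Fourth-moment bound for a centered quadratic form in a vector with i.i.d. entries; the constant
depends only on the law of the entries. -/
lemma exists_lintegral_centeredForm_le {ν : Measure ℂ} [IsProbabilityMeasure ν]
    (hmean : ∫ w, w ∂ν = 0) (hvar : ∫ w, ‖w‖ ^ 2 ∂ν = 1)
    (hmom8 : Integrable (fun w : ℂ => ‖w‖ ^ 8) ν) :
    ∃ C : ℝ, 0 ≤ C ∧ ∀ {ι : Type} [Fintype ι] {z : Ω → ι → ℂ}, Measurable z →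
      μ.map z = Measure.pi (fun _ => ν) → ∀ B : ι → ι → ℂ,
        ∫⁻ ω, ENNReal.ofReal (‖centeredForm B Finset.univ (z ω)‖ ^ 4) ∂μ
          ≤ ENNReal.ofReal (C * (∑ i, ∑ j, ‖B i j‖ ^ 2) ^ 2) := by
  have hid8 : MemLp (fun w : ℂ => w) 8 ν := by
    rw [← integrable_norm_rpow_iff (by fun_prop) (by norm_num) (by norm_num)]
    refine hmom8.congr (ae_of_all _ fun w => ?_)
    simp only [ENNReal.toReal_ofNat]
    norm_cast
  have hid2 : Integrable (fun w : ℂ => ‖w‖ ^ 2) ν :=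
    MemLp.integrable_norm_pow (p := 2) (hid8.mono_exponent (by norm_num)) (by norm_num)
  have hsq0 : ∫ w, (conj w * w - 1) ∂ν = 0 := by
    have h : ∀ w : ℂ, conj w * w - 1 = ((‖w‖ ^ 2 - 1 : ℝ) : ℂ) := fun w => by
      rw [Complex.conj_mul']; push_cast; rfl
    simp only [h]
    rw [integral_complex_ofReal, integral_sub hid2 (integrable_const 1), hvar]
    simp
  set m := √(∫ w, ‖w‖ ^ 4 ∂ν)
  set k := √(∫ w : ℂ, ‖conj w * w - 1‖ ^ 4 ∂ν)
  have hm2 : m ^ 2 = ∫ w, ‖w‖ ^ 4 ∂ν := Real.sq_sqrt (by positivity)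
  have hk2 : k ^ 2 = ∫ w : ℂ, ‖conj w * w - 1‖ ^ 4 ∂ν := Real.sq_sqrt (by positivity)
  refine ⟨(4 * √(27 * (16 * m ^ 4 + k ^ 2))) ^ 2, by positivity, ?_⟩
  intro ι _ z hz hlaw B
  have hmp := measurePreserving_coordinate hz hlaw
  have hint : ∀ {E : Type} [NormedAddCommGroup E] [NormedSpace ℝ E] (f : ℂ → E), Continuous f →
      ∀ i, ∫ ω, f (z ω i) ∂μ = ∫ w, f w ∂ν := by
    intro E _ _ f hf i
    rw [← (hmp i).map_eq]
    exact (integral_map (hmp i).measurable.aemeasurable hf.aestronglyMeasurable).symm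
  obtain ⟨hL, hle⟩ := integral_norm_centeredForm_pow_four_le (X := fun i ω => z ω i)
    (fun i => (hmp i).measurable) (iIndepFun_coordinate hz hlaw)
    (fun i => hid8.comp_measurePreserving (hmp i))
    (fun i => by rw [hint (fun w => w) continuous_id i, hmean])
    (fun i => by rw [hint (fun w => conj w * w - 1) (by fun_prop) i, hsq0])
    (m := m) (k := k) (Real.sqrt_nonneg _)
    (fun i => by rw [hint (fun w => ‖w‖ ^ 4) (by fun_prop) i, hm2])
    (fun i => by rw [hint (fun w => ‖conj w * w - 1‖ ^ 4) (by fun_prop) i, hk2]) B Finset.univ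
  rw [← ofReal_integral_eq_lintegral_ofReal (integrable_norm_pow_four hL)
    (ae_of_all _ fun ω => by positivity)]
  refine ENNReal.ofReal_le_ofReal (hle.trans_eq ?_)
  rw [mul_pow _ (∑ i, ∑ j, ‖B i j‖ ^ 2)]

lemma measurable_uncurry_centeredForm {ι : Type*} [Fintype ι] :
    Measurable fun p : (ι → ι → ℂ) × (ι → ℂ) => centeredForm p.1 Finset.univ p.2 := by
  unfold centeredForm
  fun_prop

/-- Almost sure concentration of quadratic forms in i.i.d. vectors around the normalized trace. -/
lemma ae_tendsto_centeredForm {ν : Measure ℂ} [IsProbabilityMeasure ν]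
    (hmean : ∫ w, w ∂ν = 0) (hvar : ∫ w, ‖w‖ ^ 2 ∂ν = 1)
    (hmom8 : Integrable (fun w : ℂ => ‖w‖ ^ 8) ν)
    {ι : ℕ → Type} [∀ M, Fintype (ι M)] {z : ∀ M, Ω → ι M → ℂ} {B : ∀ M, Ω → ι M → ι M → ℂ}
    (hz : ∀ M, Measurable (z M)) (hlaw : ∀ M, μ.map (z M) = Measure.pi (fun _ => ν))
    (hB : ∀ M, Measurable (B M)) (hind : ∀ M, IndepFun (B M) (z M) μ)
    (hbd : ∀ᵐ ω ∂μ, ∃ K : ℝ, ∀ M, ∑ i, ∑ j, ‖B M ω i j‖ ^ 2 ≤ K * M) :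
    ∀ᵐ ω ∂μ, Tendsto (fun M : ℕ => (M : ℂ)⁻¹ * centeredForm (B M ω) Finset.univ (z M ω)) atTop
      (nhds 0) := by
  classical
  obtain ⟨C, hC0, hC⟩ := exists_lintegral_centeredForm_le (μ := μ) hmean hvar hmom8
  let F : ∀ (_K M : ℕ), (ι M → ι M → ℂ) × (ι M → ℂ) → ℝ≥0∞ := fun K M p =>
    if ∑ i, ∑ j, ‖p.1 i j‖ ^ 2 ≤ (K : ℝ) * M then
      ENNReal.ofReal (((M : ℝ) ^ 4)⁻¹) * ENNReal.ofReal (‖centeredForm p.1 Finset.univ p.2‖ ^ 4)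
    else 0
  have hF : ∀ K M, Measurable (F K M) := fun K M => by
    refine Measurable.ite (measurableSet_le (by fun_prop) (by fun_prop)) ?_ measurable_const
    exact ((measurable_uncurry_centeredForm.norm.pow_const 4).ennreal_ofReal).const_mul _
  have hint : ∀ K M : ℕ, ∫⁻ ω, F K M (B M ω, z M ω) ∂μ
      ≤ ENNReal.ofReal (C * (K : ℝ) ^ 2 * ((M : ℝ) ^ 2)⁻¹) := by
    intro K M
    have h1 : ∫⁻ ω, F K M (B M ω, z M ω) ∂μ
        = ∫⁻ b, ∫⁻ w, F K M (b, w) ∂(μ.map (z M)) ∂(μ.map (B M)) := by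
      rw [← lintegral_prod _ (hF K M).aemeasurable, ← (hind M).map_prod_eq_prod_map_map
        (hB M).aemeasurable (hz M).aemeasurable, lintegral_map (hF K M) ((hB M).prodMk (hz M))]
    rw [h1]
    have : IsProbabilityMeasure (μ.map (B M)) := Measure.isProbabilityMeasure_map (hB M).aemeasurable
    have h2 : ∀ b, ∫⁻ w, F K M (b, w) ∂(μ.map (z M))
        ≤ ENNReal.ofReal (C * (K : ℝ) ^ 2 * ((M : ℝ) ^ 2)⁻¹) := by
      intro b
      rw [lintegral_map (f := fun w => F K M (b, w)) ((hF K M).comp measurable_prodMk_left) (hz M)]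
      by_cases hb : ∑ i, ∑ j, ‖b i j‖ ^ 2 ≤ (K : ℝ) * M
      · simp only [F, hb, if_true]
        rw [lintegral_const_mul' _ _ ENNReal.ofReal_ne_top]
        refine (mul_le_mul_right (hC (hz M) (hlaw M) b) _).trans ?_
        rw [← ENNReal.ofReal_mul (by positivity)]
        refine ENNReal.ofReal_le_ofReal ?_
        have h3 : (∑ i, ∑ j, ‖b i j‖ ^ 2) ^ 2 ≤ ((K : ℝ) * M) ^ 2 := by gcongr
        rcases Nat.eq_zero_or_pos M with rfl | hM
        · simp
        · have hM' : (M : ℝ) ≠ 0 := by positivity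
          calc ((M : ℝ) ^ 4)⁻¹ * (C * (∑ i, ∑ j, ‖b i j‖ ^ 2) ^ 2)
              ≤ ((M : ℝ) ^ 4)⁻¹ * (C * ((K : ℝ) * M) ^ 2) := by gcongr
            _ = _ := by field_simp
      · simp [F, hb]
    calc _ ≤ ∫⁻ _, ENNReal.ofReal (C * (K : ℝ) ^ 2 * ((M : ℝ) ^ 2)⁻¹) ∂(μ.map (B M)) :=
          lintegral_mono h2
      _ = _ := by simp
  have hlim : ∀ᵐ ω ∂μ, ∀ K : ℕ, Tendsto (fun M => F K M (B M ω, z M ω)) atTop (nhds 0) := by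
    rw [ae_all_iff]
    intro K
    have hmeas : ∀ M, Measurable fun ω => F K M (B M ω, z M ω) := fun M =>
      (hF K M).comp ((hB M).prodMk (hz M))
    have hsum : ∫⁻ ω, ∑' M, F K M (B M ω, z M ω) ∂μ ≠ ∞ := by
      rw [lintegral_tsum fun M => (hmeas M).aemeasurable]
      refine ne_top_of_le_ne_top ?_ (ENNReal.tsum_le_tsum (hint K))
      exact ((Real.summable_nat_pow_inv.2 one_lt_two).mul_left _).tsum_ofReal_ne_top
    filter_upwards [ae_lt_top (Measurable.tsum hmeas) hsum] with ω hω
    exact ENNReal.tendsto_atTop_zero_of_tsum_ne_top hω.ne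
  filter_upwards [hlim, hbd] with ω hω ⟨K, hK⟩
  obtain ⟨N, hN⟩ := exists_nat_ge K
  have hF' : ∀ M, F N M (B M ω, z M ω)
      = ENNReal.ofReal (‖(M : ℂ)⁻¹ * centeredForm (B M ω) Finset.univ (z M ω)‖ ^ 4) := by
    intro M
    have : ∑ i, ∑ j, ‖B M ω i j‖ ^ 2 ≤ (N : ℝ) * M := (hK M).trans (by gcongr)
    simp only [F, this, if_true]
    rw [← ENNReal.ofReal_mul (by positivity), norm_mul, mul_pow, norm_inv, Complex.norm_natCast,
      inv_pow]
  have h4 := (ENNReal.tendsto_toReal (by simp : (0 : ℝ≥0∞) ≠ ∞)).comp (hω N)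
  simp only [Function.comp_def, hF', ENNReal.toReal_zero] at h4
  have h5 : Tendsto (fun M : ℕ => √√(‖(M : ℂ)⁻¹ * centeredForm (B M ω) Finset.univ (z M ω)‖ ^ 4))
      atTop (nhds √√0) := by
    refine ((Real.continuous_sqrt.comp Real.continuous_sqrt).tendsto 0).comp (h4.congr fun M => ?_)
    exact ENNReal.toReal_ofReal (by positivity)
  rw [tendsto_zero_iff_norm_tendsto_zero]
  refine Tendsto.congr (fun M => ?_) (by simpa only [Real.sqrt_zero] using h5)
  rw [show ‖(M : ℂ)⁻¹ * centeredForm (B M ω) Finset.univ (z M ω)‖ ^ 4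
    = (‖(M : ℂ)⁻¹ * centeredForm (B M ω) Finset.univ (z M ω)‖ ^ 2) ^ 2 by ring,
    Real.sqrt_sq (by positivity), Real.sqrt_sq (by positivity)]

lemma map_sumElim_eq_pi {m n : Type*} [Fintype m] [Fintype n] {ν : Measure ℂ}
    [IsProbabilityMeasure ν] {x : Ω → m → ℂ} {y : Ω → n → ℂ} (hx : Measurable x) (hy : Measurable y)
    (hxlaw : μ.map x = Measure.pi fun _ => ν) (hylaw : μ.map y = Measure.pi fun _ => ν)
    (hxy : IndepFun x y μ) :
    μ.map (fun ω => Sum.elim (x ω) (y ω)) = Measure.pi fun _ : m ⊕ n => ν := by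
  have h := (measurePreserving_sumPiEquivProdPi_symm (X := fun _ : m ⊕ n => ℂ) fun _ => ν)
  rw [← h.map_eq, ← hxlaw, ← hylaw,
    ← hxy.map_prod_eq_prod_map_map hx.aemeasurable hy.aemeasurable,
    Measure.map_map h.measurable (hx.prodMk hy)]
  rfl

lemma centeredForm_fromBlocks {n : Type*} [Fintype n] (B : Matrix n n ℂ) (g : Fin 2 → Fin 2 → ℂ)
    (x y : n → ℂ) :
    centeredForm (fun i j => Matrix.fromBlocks (g 0 0 • B) (g 0 1 • B) (g 1 0 • B) (g 1 1 • B) i j)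
      Finset.univ (Sum.elim x y)
    = g 0 0 * (star x ⬝ᵥ B *ᵥ x) + g 0 1 * (star x ⬝ᵥ B *ᵥ y) + g 1 0 * (star y ⬝ᵥ B *ᵥ x)
      + g 1 1 * (star y ⬝ᵥ B *ᵥ y) - (g 0 0 + g 1 1) * B.trace := by
  have hq : ∀ (c : ℂ) (v w : n → ℂ), ∑ i, ∑ j, conj (v i) * (c * B i j) * w j
      = c * (star v ⬝ᵥ B *ᵥ w) := by
    intro c v w
    simp only [dotProduct, mulVec, Finset.mul_sum, Pi.star_apply, RCLike.star_def]
    exact Finset.sum_congr rfl fun i _ => Finset.sum_congr rfl fun j _ => by ring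
  simp only [centeredForm, Fintype.sum_sum_type, Sum.elim_inl, Sum.elim_inr, fromBlocks_apply₁₁,
    fromBlocks_apply₁₂, fromBlocks_apply₂₁, fromBlocks_apply₂₂, Finset.sum_add_distrib,
    Matrix.smul_apply, smul_eq_mul, hq, ← Finset.mul_sum]
  simp only [Matrix.trace, Matrix.diag_apply]
  ring

/-- Almost sure concentration of the sesquilinear forms built from two independent i.i.d. vectors,
with coefficients `g`. -/
lemma ae_tendsto_sesqForm {ν : Measure ℂ} [IsProbabilityMeasure ν]
    (hmean : ∫ w, w ∂ν = 0) (hvar : ∫ w, ‖w‖ ^ 2 ∂ν = 1)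
    (hmom8 : Integrable (fun w : ℂ => ‖w‖ ^ 8) ν)
    {x y : ∀ M : ℕ, Ω → (Fin M → ℂ)} {B : ∀ M : ℕ, Ω → Matrix (Fin M) (Fin M) ℂ}
    (hx : ∀ M, Measurable (x M)) (hy : ∀ M, Measurable (y M))
    (hxlaw : ∀ M, μ.map (x M) = Measure.pi fun _ => ν)
    (hylaw : ∀ M, μ.map (y M) = Measure.pi fun _ => ν)
    (hxy : ∀ M, IndepFun (x M) (y M) μ)
    (hB : ∀ M, Measurable fun ω (p : Fin M × Fin M) => B M ω p.1 p.2)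
    (hind : ∀ M, IndepFun (fun ω => (x M ω, y M ω))
      (fun ω (p : Fin M × Fin M) => B M ω p.1 p.2) μ)
    (hbd : ∀ᵐ ω ∂μ, ∃ K : ℝ, ∀ M, ∑ i, ∑ j, ‖B M ω i j‖ ^ 2 ≤ K * M)
    (g : Fin 2 → Fin 2 → ℂ) :
    ∀ᵐ ω ∂μ, Tendsto (fun M : ℕ => (M : ℂ)⁻¹ * (g 0 0 * (star (x M ω) ⬝ᵥ B M ω *ᵥ x M ω)
      + g 0 1 * (star (x M ω) ⬝ᵥ B M ω *ᵥ y M ω) + g 1 0 * (star (y M ω) ⬝ᵥ B M ω *ᵥ x M ω)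
      + g 1 1 * (star (y M ω) ⬝ᵥ B M ω *ᵥ y M ω) - (g 0 0 + g 1 1) * (B M ω).trace))
      atTop (nhds 0) := by
  have hblock : ∀ M, Measurable fun (b : Fin M × Fin M → ℂ) (i j : Fin M ⊕ Fin M) =>
      Matrix.fromBlocks (g 0 0 • Matrix.of fun i j => b (i, j)) (g 0 1 • Matrix.of fun i j => b (i, j))
        (g 1 0 • Matrix.of fun i j => b (i, j)) (g 1 1 • Matrix.of fun i j => b (i, j)) i j := by
    intro M
    refine measurable_pi_lambda _ fun i => measurable_pi_lambda _ fun j => ?_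
    rcases i with i | i <;> rcases j with j | j <;>
      simp only [fromBlocks_apply₁₁, fromBlocks_apply₁₂, fromBlocks_apply₂₁, fromBlocks_apply₂₂,
        Matrix.smul_apply, Matrix.of_apply, smul_eq_mul] <;> fun_prop
  have helim : ∀ M, Measurable fun p : (Fin M → ℂ) × (Fin M → ℂ) => Sum.elim p.1 p.2 := by
    intro M
    refine measurable_pi_lambda _ fun i => ?_
    rcases i with i | i <;> simp only [Sum.elim_inl, Sum.elim_inr] <;> fun_prop
  have h := ae_tendsto_centeredForm (μ := μ) hmean hvar hmom8 (ι := fun M => Fin M ⊕ Fin M)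
    (z := fun M ω => Sum.elim (x M ω) (y M ω))
    (B := fun M ω i j => Matrix.fromBlocks (g 0 0 • B M ω) (g 0 1 • B M ω) (g 1 0 • B M ω)
      (g 1 1 • B M ω) i j)
    (fun M => (helim M).comp ((hx M).prodMk (hy M)))
    (fun M => map_sumElim_eq_pi (hx M) (hy M) (hxlaw M) (hylaw M) (hxy M))
    (fun M => (hblock M).comp (hB M))
    (fun M => ((hind M).comp (helim M) (hblock M)).symm) ?_
  · filter_upwards [h] with ω hω
    simpa only [centeredForm_fromBlocks] using hω
  · filter_upwards [hbd] with ω ⟨K, hK⟩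
    refine ⟨(‖g 0 0‖ ^ 2 + ‖g 0 1‖ ^ 2 + ‖g 1 0‖ ^ 2 + ‖g 1 1‖ ^ 2) * K, fun M => ?_⟩
    simp only [Fintype.sum_sum_type, fromBlocks_apply₁₁, fromBlocks_apply₁₂, fromBlocks_apply₂₁,
      fromBlocks_apply₂₂, Finset.sum_add_distrib, Matrix.smul_apply, smul_eq_mul, norm_mul, mul_pow,
      ← Finset.mul_sum]
    have := mul_le_mul_of_nonneg_left (hK M)
      (by positivity : 0 ≤ ‖g 0 0‖ ^ 2 + ‖g 0 1‖ ^ 2 + ‖g 1 0‖ ^ 2 + ‖g 1 1‖ ^ 2)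
    linarith

end Concentration

section SpectralNorm

open scoped Matrix.Norms.L2Operator

lemma specNorm_mul_le {n : Type*} [Fintype n] [DecidableEq n] (A B : Matrix n n ℂ) :
    specNorm (A * B) ≤ specNorm A * specNorm B :=
  Matrix.l2_opNorm_mul A B

lemma specNorm_nonneg {n : Type*} [Fintype n] [DecidableEq n] (A : Matrix n n ℂ) :
    0 ≤ specNorm A :=
  norm_nonneg _

lemma sum_norm_sq_column_le {n : Type*} [Fintype n] [DecidableEq n] (B : Matrix n n ℂ) (j : n) :
    ∑ i, ‖B i j‖ ^ 2 ≤ specNorm B ^ 2 := by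
  have h := (LinearMap.toContinuousLinearMap (Matrix.toEuclideanLin B)).le_opNorm
    (EuclideanSpace.single j (1 : ℂ))
  have h2 := pow_le_pow_left₀ (norm_nonneg _) h 2
  rw [EuclideanSpace.norm_sq_eq] at h2
  simpa [specNorm, Matrix.toLpLin_apply] using h2

lemma sum_norm_sq_le_specNorm {M : ℕ} (B : Matrix (Fin M) (Fin M) ℂ) :
    ∑ i, ∑ j, ‖B i j‖ ^ 2 ≤ specNorm B ^ 2 * M := by
  rw [Finset.sum_comm]
  refine (Finset.sum_le_sum fun j _ => sum_norm_sq_column_le B j).trans_eq ?_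
  simp [mul_comm]

lemma norm_inv_mul_trace_le {M : ℕ} (B : Matrix (Fin M) (Fin M) ℂ) :
    ‖(M : ℂ)⁻¹ * B.trace‖ ≤ specNorm B := by
  have hdiag : ∀ i, ‖B i i‖ ≤ specNorm B := fun i => by
    refine abs_le_of_sq_le_sq' ?_ (specNorm_nonneg B) |>.2
    exact (Finset.single_le_sum (f := fun k => ‖B k i‖ ^ 2) (fun _ _ => by positivity)
      (Finset.mem_univ i)).trans (sum_norm_sq_column_le B i)
  have htr : ‖B.trace‖ ≤ M * specNorm B :=
    (norm_sum_le_of_le _ fun i _ => hdiag i).trans_eq (by simp)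
  rw [norm_mul, norm_inv, Complex.norm_natCast]
  rcases Nat.eq_zero_or_pos M with rfl | hM
  · simpa using specNorm_nonneg B
  · rw [inv_mul_le_iff₀ (by positivity)]
    exact htr

end SpectralNorm

section RankOne

variable {n : Type*} [Fintype n] [DecidableEq n]

lemma one_le_norm_one_add {w : ℂ} (hw : 0 ≤ w) : 1 ≤ ‖1 + w‖ := by
  obtain ⟨h, -⟩ := Complex.nonneg_iff.1 hw
  calc (1 : ℝ) ≤ (1 + w).re := by simpa using h
    _ ≤ ‖1 + w‖ := Complex.re_le_norm _

lemma one_add_ne_zero_of_nonneg {w : ℂ} (hw : 0 ≤ w) : 1 + w ≠ 0 := fun h => by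
  have := one_le_norm_one_add hw
  rw [h, norm_zero] at this
  linarith

/-- The Sherman–Morrison formula. -/
lemma inv_add_smul_vecMulVec {A : Matrix n n ℂ} (hA : IsUnit A.det) (t : ℂ) (v w : n → ℂ)
    (h : 1 + t * (w ⬝ᵥ A⁻¹ *ᵥ v) ≠ 0) :
    (A + t • vecMulVec v w)⁻¹
      = A⁻¹ - (t / (1 + t * (w ⬝ᵥ A⁻¹ *ᵥ v))) • vecMulVec (A⁻¹ *ᵥ v) (w ᵥ* A⁻¹) := by
  apply Matrix.inv_eq_right_inv
  have h1 : vecMulVec v w * vecMulVec (A⁻¹ *ᵥ v) (w ᵥ* A⁻¹)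
      = (w ⬝ᵥ A⁻¹ *ᵥ v) • vecMulVec v (w ᵥ* A⁻¹) := by
    rw [vecMulVec_mul_vecMulVec, vecMulVec_smul]
  have h2 : A * vecMulVec (A⁻¹ *ᵥ v) (w ᵥ* A⁻¹) = vecMulVec v (w ᵥ* A⁻¹) := by
    rw [mul_vecMulVec, mulVec_mulVec, Matrix.mul_nonsing_inv _ hA, one_mulVec]
  have h3 : vecMulVec v w * A⁻¹ = vecMulVec v (w ᵥ* A⁻¹) := vecMulVec_mul _ _ _
  rw [add_mul, mul_sub, mul_sub, Matrix.mul_nonsing_inv _ hA, Matrix.mul_smul, h2,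
    Matrix.smul_mul, h3, Matrix.mul_smul, Matrix.smul_mul, h1, sub_add_eq_add_sub, add_sub_assoc, add_eq_left]
  simp only [smul_smul, ← sub_smul]
  convert zero_smul ℂ (vecMulVec v (w ᵥ* A⁻¹)) using 2
  field_simp
  ring

/-- A sesquilinear form in the inverse of a rank-one perturbation. -/
lemma dotProduct_inv_add_smul_vecMulVec {A : Matrix n n ℂ} (hA : A.PosDef) (L R : Matrix n n ℂ)
    {t : ℂ} (ht : 0 ≤ t) (v p q : n → ℂ) :
    t * (p ⬝ᵥ L *ᵥ ((A + t • vecMulVec v (star v))⁻¹ *ᵥ (R *ᵥ q)))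
      = t * (p ⬝ᵥ (L * A⁻¹ * R) *ᵥ q) - (t * (p ⬝ᵥ (L * A⁻¹) *ᵥ v))
        * (t * (star v ⬝ᵥ (A⁻¹ * R) *ᵥ q)) / (1 + t * (star v ⬝ᵥ A⁻¹ *ᵥ v)) := by
  have hd : 0 ≤ t * (star v ⬝ᵥ A⁻¹ *ᵥ v) :=
    mul_nonneg ht (hA.inv.posSemidef.dotProduct_mulVec_nonneg v)
  rw [inv_add_smul_vecMulVec ((Matrix.isUnit_iff_isUnit_det _).1 hA.isUnit) t v (star v)
    (one_add_ne_zero_of_nonneg hd), sub_mulVec, smul_mulVec, vecMulVec_mulVec, mulVec_sub,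
    mulVec_smul, dotProduct_sub, dotProduct_smul]
  simp only [op_smul_eq_smul, mulVec_smul, dotProduct_smul, mulVec_mulVec, smul_eq_mul,
    Matrix.mul_assoc, ← dotProduct_mulVec]
  ring

end RankOne

section Limits

open Asymptotics

lemma tendsto_sub_mul_div_sub {q p r d uq uL uR u : ℕ → ℂ} {a b : ℂ} {KL KR : ℝ}
    (hq : Tendsto (fun M => q M - uq M) atTop (nhds 0))
    (hp : Tendsto (fun M => p M - a * uL M) atTop (nhds 0))
    (hr : Tendsto (fun M => r M - b * uR M) atTop (nhds 0))
    (hd : Tendsto (fun M => d M - u M) atTop (nhds 0))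
    (huL : ∀ M, ‖uL M‖ ≤ KL) (huR : ∀ M, ‖uR M‖ ≤ KR)
    (hd1 : ∀ M, 1 ≤ ‖1 + d M‖) (hu1 : ∀ M, 1 ≤ ‖1 + u M‖) :
    Tendsto (fun M => q M - p M * r M / (1 + d M) - (uq M - a * b * uL M * uR M / (1 + u M)))
      atTop (nhds 0) := by
  have hbig : ∀ {f : ℕ → ℂ} {K : ℝ}, (∀ M, ‖f M‖ ≤ K) → f =O[atTop] (fun _ => (1 : ℂ)) :=
    fun {f K} h => IsBigO.of_bound K (Eventually.of_forall fun M => by simpa using h M)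
  have hinv : ∀ {f : ℕ → ℂ}, (∀ M, 1 ≤ ‖1 + f M‖) →
      (fun M => (1 + f M)⁻¹) =O[atTop] (fun _ => (1 : ℂ)) := fun {f} h =>
    hbig (K := 1) fun M => by rw [norm_inv]; exact inv_le_one_of_one_le₀ (h M)
  have hL := hbig huL
  have hR := hbig huR
  have hdi := hinv hd1
  have hui := hinv hu1
  have hp' := (isLittleO_one_iff ℂ).2 hp
  have hr' := (isLittleO_one_iff ℂ).2 hr
  have hd' := (isLittleO_one_iff ℂ).2 hd
  have hrO : r =O[atTop] (fun _ => (1 : ℂ)) := by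
    simpa using hr'.isBigO.add (hR.const_mul_left b)
  have e₁ := (hp'.mul_isBigO hrO).mul_isBigO hdi
  have e₂ := ((hL.const_mul_left a).mul_isLittleO hr').mul_isBigO hdi
  have e₃ := ((((hL.const_mul_left (a * b)).mul hR).mul_isLittleO hd').mul_isBigO hdi).mul_isBigO
    hui
  simp only [mul_one] at e₁ e₂ e₃
  have e := (isLittleO_one_iff ℂ).1 ((((isLittleO_one_iff ℂ).2 hq).sub (e₁.add e₂)).add e₃)
  refine e.congr fun M => ?_
  have h1 : 1 + d M ≠ 0 := norm_pos_iff.1 (one_pos.trans_le (hd1 M))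
  have h2 : 1 + u M ≠ 0 := norm_pos_iff.1 (one_pos.trans_le (hu1 M))
  field_simp
  ring

end Limits

section Measurability

lemma measurable_matrix_mul {Ω n : Type*} [MeasurableSpace Ω] [Fintype n]
    {A B : Ω → Matrix n n ℂ} (hA : Measurable fun ω (p : n × n) => A ω p.1 p.2)
    (hB : Measurable fun ω (p : n × n) => B ω p.1 p.2) :
    Measurable fun ω (p : n × n) => (A ω * B ω) p.1 p.2 := by
  refine measurable_pi_lambda _ fun p => ?_
  simp only [Matrix.mul_apply]
  refine Finset.measurable_fun_sum _ fun k _ => ?_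
  have h1 : Measurable fun ω => A ω p.1 k := (measurable_pi_apply (p.1, k)).comp hA
  have h2 : Measurable fun ω => B ω k p.2 := (measurable_pi_apply (k, p.2)).comp hB
  exact h1.mul h2

lemma measurable_matrix_det {Ω n : Type*} [MeasurableSpace Ω] [Fintype n] [DecidableEq n]
    {A : Ω → Matrix n n ℂ} (hA : ∀ i j, Measurable fun ω => A ω i j) :
    Measurable fun ω => (A ω).det := by
  simp only [Matrix.det_apply']
  exact Finset.measurable_fun_sum _ fun σ _ =>
    (Finset.measurable_fun_prod _ fun i _ => hA (σ i) i).const_mul _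

lemma measurable_matrix_inv {Ω n : Type*} [MeasurableSpace Ω] [Fintype n] [DecidableEq n]
    {A : Ω → Matrix n n ℂ} (hA : Measurable fun ω (p : n × n) => A ω p.1 p.2) :
    Measurable fun ω (p : n × n) => (A ω)⁻¹ p.1 p.2 := by
  have hA' : ∀ i j, Measurable fun ω => A ω i j := fun i j => (measurable_pi_apply (i, j)).comp hA
  refine measurable_pi_lambda _ fun p => ?_
  simp only [Matrix.inv_def, Matrix.smul_apply, Ring.inverse_eq_inv', smul_eq_mul,
    Matrix.adjugate_apply]
  refine (measurable_matrix_det hA').inv.mul (measurable_matrix_det fun i j => ?_)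
  by_cases h : i = p.2
  · simp only [h, Matrix.updateRow_self]
    exact measurable_const
  · simp only [Matrix.updateRow_ne h]
    exact hA' i j

end Measurability

/-- Deterministic equivalents for the quadratic forms
`(1/M)xᴴL A⁻¹ R x` and `(1/M)xᴴL A⁻¹ R y` with
`A = Ā + (1/M)(c₀xxᴴ + c₁yyᴴ + c₂xyᴴ + c₂yxᴴ)`, `c₀ + c₁ = 1`,
`c₀c₁ − c₂² = 0`, in terms of `u = (1/M)tr Ā⁻¹`, `u_L = (1/M)tr(LĀ⁻¹)`,
`u_R = (1/M)tr(Ā⁻¹R)`, `u_{LR} = (1/M)tr(LĀ⁻¹R)`. -/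
theorem stmt10 {Ω : Type*} [MeasurableSpace Ω] (μ : Measure Ω) [IsProbabilityMeasure μ]
    (Abar L R : ∀ M : ℕ, Ω → Matrix (Fin M) (Fin M) ℂ)
    (x y : ∀ M : ℕ, Ω → (Fin M → ℂ))
    (ν : Measure ℂ) [IsProbabilityMeasure ν]
    (hmean : ∫ w, w ∂ν = 0)
    (hvar : ∫ w, ‖w‖ ^ 2 ∂ν = 1)
    (hmom8 : Integrable (fun w : ℂ => ‖w‖ ^ 8) ν)
    (hxmeas : ∀ M, Measurable (x M)) (hymeas : ∀ M, Measurable (y M))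
    (hAbarmeas : ∀ M, Measurable fun ω (p : Fin M × Fin M) => Abar M ω p.1 p.2)
    (hLmeas : ∀ M, Measurable fun ω (p : Fin M × Fin M) => L M ω p.1 p.2)
    (hRmeas : ∀ M, Measurable fun ω (p : Fin M × Fin M) => R M ω p.1 p.2)
    (hxlaw : ∀ M, Measure.map (x M) μ = Measure.pi fun _ : Fin M => ν)
    (hylaw : ∀ M, Measure.map (y M) μ = Measure.pi fun _ : Fin M => ν)
    (hxy : ∀ M, IndepFun (x M) (y M) μ)
    (hxyLRA : ∀ M, IndepFun (fun ω => (x M ω, y M ω))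
      (fun ω => ((fun p : Fin M × Fin M => L M ω p.1 p.2),
                 (fun p : Fin M × Fin M => R M ω p.1 p.2),
                 (fun p : Fin M × Fin M => Abar M ω p.1 p.2))) μ)
    (hAbarpd : ∀ M ω, (Abar M ω).PosDef)
    (hAbarb : ∀ᵐ ω ∂μ, ∃ C : ℝ, ∀ M, specNorm (Abar M ω) ≤ C)
    (hAbarinvb : ∀ᵐ ω ∂μ, ∃ C : ℝ, ∀ M, specNorm ((Abar M ω)⁻¹) ≤ C)
    (hLb : ∀ᵐ ω ∂μ, ∃ C : ℝ, ∀ M, specNorm (L M ω) ≤ C)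
    (hRb : ∀ᵐ ω ∂μ, ∃ C : ℝ, ∀ M, specNorm (R M ω) ≤ C)
    (c0 c1 c2 : ℝ) (hc0 : 0 ≤ c0) (hc1 : 0 ≤ c1) (hc2 : 0 ≤ c2)
    (hsum : c0 + c1 = 1) (hdet : c0 * c1 - c2 ^ 2 = 0) :
    ∀ᵐ ω ∂μ,
      (Tendsto (fun M : ℕ =>
        let xv := x M ω
        let yv := y M ω
        let Amat := Abar M ω + (M : ℂ)⁻¹ • ((c0 : ℂ) • Matrix.vecMulVec xv (star xv)
          + (c1 : ℂ) • Matrix.vecMulVec yv (star yv)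
          + (c2 : ℂ) • Matrix.vecMulVec xv (star yv)
          + (c2 : ℂ) • Matrix.vecMulVec yv (star xv))
        let u := (M : ℂ)⁻¹ * Matrix.trace ((Abar M ω)⁻¹)
        let uL := (M : ℂ)⁻¹ * Matrix.trace (L M ω * (Abar M ω)⁻¹)
        let uR := (M : ℂ)⁻¹ * Matrix.trace ((Abar M ω)⁻¹ * R M ω)
        let uLR := (M : ℂ)⁻¹ * Matrix.trace (L M ω * (Abar M ω)⁻¹ * R M ω)
        (M : ℂ)⁻¹ * (star xv ⬝ᵥ (L M ω).mulVec (Amat⁻¹.mulVec ((R M ω).mulVec xv)))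
          - (uLR - (c0 : ℂ) * uL * uR * (1 + (c1 : ℂ) * u) / (1 + u)
              + ((c2 ^ 2 : ℝ) : ℂ) * uL * uR * u / (1 + u)))
        atTop (nhds 0))
      ∧ (Tendsto (fun M : ℕ =>
        let xv := x M ω
        let yv := y M ω
        let Amat := Abar M ω + (M : ℂ)⁻¹ • ((c0 : ℂ) • Matrix.vecMulVec xv (star xv)
          + (c1 : ℂ) • Matrix.vecMulVec yv (star yv)
          + (c2 : ℂ) • Matrix.vecMulVec xv (star yv)
          + (c2 : ℂ) • Matrix.vecMulVec yv (star xv))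
        let u := (M : ℂ)⁻¹ * Matrix.trace ((Abar M ω)⁻¹)
        let uL := (M : ℂ)⁻¹ * Matrix.trace (L M ω * (Abar M ω)⁻¹)
        let uR := (M : ℂ)⁻¹ * Matrix.trace ((Abar M ω)⁻¹ * R M ω)
        (M : ℂ)⁻¹ * (star xv ⬝ᵥ (L M ω).mulVec (Amat⁻¹.mulVec ((R M ω).mulVec yv)))
          - ((c1 : ℂ) * (c2 : ℂ) * uL * uR * u / (1 + u)
              - (c2 : ℂ) * uL * uR * (1 + (c1 : ℂ) * u) / (1 + u)))
        atTop (nhds 0)) := by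
  obtain ⟨a, b, ha, hb, hab⟩ : ∃ a b : ℝ, a * a = c0 ∧ b * b = c1 ∧ a * b = c2 :=
    ⟨√c0, √c1, Real.mul_self_sqrt hc0, Real.mul_self_sqrt hc1, by
      rw [← Real.sqrt_mul hc0, show c0 * c1 = c2 ^ 2 by linarith, Real.sqrt_sq hc2]⟩
  have hab1 : (a : ℂ) * a + b * b = 1 := by
    exact_mod_cast (by rw [ha, hb, hsum] : a * a + b * b = 1)
  -- the concentration lemma for a matrix built measurably from `L`, `R` and `Abar`
  have conc : ∀ T : ∀ M : ℕ, Matrix (Fin M) (Fin M) ℂ → Matrix (Fin M) (Fin M) ℂ →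
      Matrix (Fin M) (Fin M) ℂ → Matrix (Fin M) (Fin M) ℂ,
      (∀ M, Measurable fun (q : (Fin M × Fin M → ℂ) × (Fin M × Fin M → ℂ) × (Fin M × Fin M → ℂ))
        (p : Fin M × Fin M) => T M (.of fun i j => q.1 (i, j)) (.of fun i j => q.2.1 (i, j))
          (.of fun i j => q.2.2 (i, j)) p.1 p.2) →
      (∀ᵐ ω ∂μ, ∃ C : ℝ, ∀ M, specNorm (T M (L M ω) (R M ω) (Abar M ω)) ≤ C) →
      ∀ g : Fin 2 → Fin 2 → ℂ, ∀ᵐ ω ∂μ, Tendsto (fun M : ℕ => (M : ℂ)⁻¹ *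
        (g 0 0 * (star (x M ω) ⬝ᵥ T M (L M ω) (R M ω) (Abar M ω) *ᵥ x M ω)
        + g 0 1 * (star (x M ω) ⬝ᵥ T M (L M ω) (R M ω) (Abar M ω) *ᵥ y M ω)
        + g 1 0 * (star (y M ω) ⬝ᵥ T M (L M ω) (R M ω) (Abar M ω) *ᵥ x M ω)
        + g 1 1 * (star (y M ω) ⬝ᵥ T M (L M ω) (R M ω) (Abar M ω) *ᵥ y M ω)
        - (g 0 0 + g 1 1) * (T M (L M ω) (R M ω) (Abar M ω)).trace)) atTop (nhds 0) := by
    intro T hT hTb g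
    refine ae_tendsto_sesqForm (B := fun M ω => T M (L M ω) (R M ω) (Abar M ω)) hmean hvar hmom8
      hxmeas hymeas hxlaw hylaw hxy ?_ ?_ ?_ g
    · exact fun M => (hT M).comp ((hLmeas M).prodMk ((hRmeas M).prodMk (hAbarmeas M)))
    · exact fun M => (hxyLRA M).comp measurable_id (hT M)
    · filter_upwards [hTb] with ω ⟨C, hC⟩
      refine ⟨C ^ 2, fun M => (sum_norm_sq_le_specNorm _).trans ?_⟩
      have := specNorm_nonneg (T M (L M ω) (R M ω) (Abar M ω))
      gcongr
      exact hC M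
  have mL : ∀ M, Measurable fun (q : (Fin M × Fin M → ℂ) × (Fin M × Fin M → ℂ) ×
      (Fin M × Fin M → ℂ)) (p : Fin M × Fin M) =>
        (Matrix.of fun i j => q.1 (i, j) : Matrix (Fin M) (Fin M) ℂ) p.1 p.2 :=
    fun M => measurable_fst
  have mR : ∀ M, Measurable fun (q : (Fin M × Fin M → ℂ) × (Fin M × Fin M → ℂ) ×
      (Fin M × Fin M → ℂ)) (p : Fin M × Fin M) =>
        (Matrix.of fun i j => q.2.1 (i, j) : Matrix (Fin M) (Fin M) ℂ) p.1 p.2 :=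
    fun M => measurable_fst.comp measurable_snd
  have mA : ∀ M, Measurable fun (q : (Fin M × Fin M → ℂ) × (Fin M × Fin M → ℂ) ×
      (Fin M × Fin M → ℂ)) (p : Fin M × Fin M) =>
        (Matrix.of fun i j => q.2.2 (i, j) : Matrix (Fin M) (Fin M) ℂ)⁻¹ p.1 p.2 :=
    fun M => measurable_matrix_inv (measurable_snd.comp measurable_snd)
  have bmul : ∀ P Q : ∀ M : ℕ, Ω → Matrix (Fin M) (Fin M) ℂ,
      (∀ᵐ ω ∂μ, ∃ C : ℝ, ∀ M, specNorm (P M ω) ≤ C) →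
      (∀ᵐ ω ∂μ, ∃ C : ℝ, ∀ M, specNorm (Q M ω) ≤ C) →
      ∀ᵐ ω ∂μ, ∃ C : ℝ, ∀ M, specNorm (P M ω * Q M ω) ≤ C := by
    intro P Q hP hQ
    filter_upwards [hP, hQ] with ω ⟨C, hC⟩ ⟨C', hC'⟩
    exact ⟨C * C', fun M => (specNorm_mul_le _ _).trans (mul_le_mul (hC M) (hC' M)
      (specNorm_nonneg _) ((specNorm_nonneg _).trans (hC M)))⟩
  have bLA := bmul L (fun M ω => (Abar M ω)⁻¹) hLb hAbarinvb
  have bAR := bmul (fun M ω => (Abar M ω)⁻¹) R hAbarinvb hRb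
  have bLAR := bmul (fun M ω => L M ω * (Abar M ω)⁻¹) R bLA hRb
  have cLAR := conc (fun _ l r A => l * A⁻¹ * r)
    (fun M => measurable_matrix_mul (measurable_matrix_mul (mL M) (mA M)) (mR M)) bLAR
  have cLA := conc (fun _ l _ A => l * A⁻¹) (fun M => measurable_matrix_mul (mL M) (mA M)) bLA
  have cAR := conc (fun _ _ r A => A⁻¹ * r) (fun M => measurable_matrix_mul (mA M) (mR M)) bAR
  have cA := conc (fun _ _ _ A => A⁻¹) mA hAbarinvb
  filter_upwards [bLA, bAR, cLAR !![1, 0; 0, 0], cLAR !![0, 1; 0, 0], cLA !![(a : ℂ), b; 0, 0],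
    cAR !![(a : ℂ), 0; b, 0], cAR !![0, (a : ℂ); 0, b],
    cA !![(a : ℂ) * a, a * b; a * b, b * b]] with ω ⟨KL, hKL⟩ ⟨KR, hKR⟩ hxx hxy' hxv hvx hvy hvv
  simp only [Matrix.of_apply, Matrix.cons_val', Matrix.cons_val_zero, Matrix.cons_val_one,
    Matrix.cons_val_fin_one, one_mul, zero_mul, add_zero, zero_add, sub_zero, hab1]
    at hxx hxy' hxv hvx hvy hvv
  set v : ∀ M, Fin M → ℂ := fun M => (a : ℂ) • x M ω + (b : ℂ) • y M ω with hv
  have hstar : ∀ M, star (v M) = (a : ℂ) • star (x M ω) + (b : ℂ) • star (y M ω) := fun M => by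
    simp [hv, star_smul]
  have hpert : ∀ M, (c0 : ℂ) • Matrix.vecMulVec (x M ω) (star (x M ω))
      + (c1 : ℂ) • Matrix.vecMulVec (y M ω) (star (y M ω))
      + (c2 : ℂ) • Matrix.vecMulVec (x M ω) (star (y M ω))
      + (c2 : ℂ) • Matrix.vecMulVec (y M ω) (star (x M ω)) = Matrix.vecMulVec (v M) (star (v M)) := by
    intro M
    rw [hstar, ← ha, ← hb, ← hab]
    ext i j
    simp only [hv, Matrix.add_apply, Matrix.smul_apply, vecMulVec_apply, Pi.add_apply,
      Pi.smul_apply, smul_eq_mul, Complex.ofReal_mul]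
    ring
  have ht : ∀ M : ℕ, (0 : ℂ) ≤ (M : ℂ)⁻¹ := fun M => by
    rw [← Complex.ofReal_natCast, ← Complex.ofReal_inv]
    exact Complex.zero_le_real.2 (by positivity)
  have hxv' : Tendsto (fun M : ℕ => (M : ℂ)⁻¹ * (star (x M ω) ⬝ᵥ (L M ω * (Abar M ω)⁻¹) *ᵥ v M)
      - a * ((M : ℂ)⁻¹ * (L M ω * (Abar M ω)⁻¹).trace)) atTop (nhds 0) := by
    refine hxv.congr fun M => ?_
    simp only [hv, mulVec_add, mulVec_smul, dotProduct_add, dotProduct_smul, smul_eq_mul]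
    ring
  have hvx' : Tendsto (fun M : ℕ => (M : ℂ)⁻¹ * (star (v M) ⬝ᵥ ((Abar M ω)⁻¹ * R M ω) *ᵥ x M ω)
      - a * ((M : ℂ)⁻¹ * ((Abar M ω)⁻¹ * R M ω).trace)) atTop (nhds 0) := by
    refine hvx.congr fun M => ?_
    simp only [hstar, add_dotProduct, smul_dotProduct, smul_eq_mul]
    ring
  have hvy' : Tendsto (fun M : ℕ => (M : ℂ)⁻¹ * (star (v M) ⬝ᵥ ((Abar M ω)⁻¹ * R M ω) *ᵥ y M ω)
      - b * ((M : ℂ)⁻¹ * ((Abar M ω)⁻¹ * R M ω).trace)) atTop (nhds 0) := by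
    refine hvy.congr fun M => ?_
    simp only [hstar, add_dotProduct, smul_dotProduct, smul_eq_mul]
    ring
  have hvv' : Tendsto (fun M : ℕ => (M : ℂ)⁻¹ * (star (v M) ⬝ᵥ (Abar M ω)⁻¹ *ᵥ v M)
      - (M : ℂ)⁻¹ * ((Abar M ω)⁻¹).trace) atTop (nhds 0) := by
    refine hvv.congr fun M => ?_
    simp only [hstar]
    simp only [hv, mulVec_add, mulVec_smul, dotProduct_add, dotProduct_smul, add_dotProduct,
      smul_dotProduct, smul_eq_mul]
    ring
  have hd1 : ∀ M : ℕ, 1 ≤ ‖1 + (M : ℂ)⁻¹ * (star (v M) ⬝ᵥ (Abar M ω)⁻¹ *ᵥ v M)‖ := fun M =>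
    one_le_norm_one_add (mul_nonneg (ht M)
      ((hAbarpd M ω).inv.posSemidef.dotProduct_mulVec_nonneg (v M)))
  have hu1 : ∀ M : ℕ, 1 ≤ ‖1 + (M : ℂ)⁻¹ * ((Abar M ω)⁻¹).trace‖ := fun M =>
    one_le_norm_one_add (mul_nonneg (ht M) (hAbarpd M ω).inv.posSemidef.trace_nonneg)
  have huL : ∀ M : ℕ, ‖(M : ℂ)⁻¹ * (L M ω * (Abar M ω)⁻¹).trace‖ ≤ KL := fun M =>
    (norm_inv_mul_trace_le _).trans (hKL M)
  have huR : ∀ M : ℕ, ‖(M : ℂ)⁻¹ * ((Abar M ω)⁻¹ * R M ω).trace‖ ≤ KR := fun M =>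
    (norm_inv_mul_trace_le _).trans (hKR M)
  have hc0' : (c0 : ℂ) = a * a := by exact_mod_cast ha.symm
  have hc1' : (c1 : ℂ) = b * b := by exact_mod_cast hb.symm
  have hc2' : (c2 : ℂ) = a * b := by exact_mod_cast hab.symm
  simp only [hpert, dotProduct_inv_add_smul_vecMulVec (hAbarpd _ ω) _ _ (ht _)]
  simp only [hc0', hc1', hc2', Complex.ofReal_pow]
  constructor
  · refine (tendsto_sub_mul_div_sub
      (q := fun M => (M : ℂ)⁻¹ *
        (star (x M ω) ⬝ᵥ (L M ω * (Abar M ω)⁻¹ * R M ω) *ᵥ x M ω))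
      (uq := fun M => (M : ℂ)⁻¹ * (L M ω * (Abar M ω)⁻¹ * R M ω).trace)
      (hxx.congr fun M => by ring) hxv' hvx' hvv' huL huR hd1 hu1).congr fun M => ?_
    ring
  · refine (tendsto_sub_mul_div_sub
      (q := fun M => (M : ℂ)⁻¹ *
        (star (x M ω) ⬝ᵥ (L M ω * (Abar M ω)⁻¹ * R M ω) *ᵥ y M ω))
      (uq := fun _ => 0)
      (hxy'.congr fun M => by ring) hxv' hvy' hvv' huL huR hd1 hu1).congr fun M => ?_
    ring
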